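/- Let h: [0,∞) → [0,∞) be of class C² with h(0) = h'(0) = 0, and suppose there are constants c₁, c₂ > 0 and an exponent μ with 1 < μ < 2 such that c₁(1+t)^{−μ} ≤ min{h''(t), h'(t)/t} and max{h''(t), h'(t)/t} ≤ c₂/(1+t) for all t ≥ 0. Suppose u ∈ C¹(ℝ², ℝ²) is divergence-free, bounded, and a weak solution of the stationary generalized Navier–Stokes system with dissipative potential H(ε) = h(|ε|). Then for every x₀ ∈ ℝ², lim_{R → ∞} R^{−2} ∫_{Q_{2R}(x₀)} |ε(u)| dx = 0, where Q_R(x₀) := {x ∈ ℝ² : |x₁ − x₀₁| < R and |x₂ − x₀₂| < R}. -/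

import Mathlib

noncomputable section

open MeasureTheory Real Filter

/-- Partial derivative ∂ₖu(x) ∈ ℝⁿ of a vector field u : ℝⁿ → ℝⁿ. -/
def pd {n : ℕ} (u : EuclideanSpace ℝ (Fin n) → EuclideanSpace ℝ (Fin n))
    (k : Fin n) (x : EuclideanSpace ℝ (Fin n)) : EuclideanSpace ℝ (Fin n) :=
  fderiv ℝ u x (EuclideanSpace.single k 1)

/-- Divergence of u at x. -/
def divg {n : ℕ} (u : EuclideanSpace ℝ (Fin n) → EuclideanSpace ℝ (Fin n))
    (x : EuclideanSpace ℝ (Fin n)) : ℝ :=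
  ∑ k, pd u k x k

/-- Symmetric gradient ε(u)(x) = (1/2)(∇u + (∇u)ᵀ), entry (i,j) = (∂ⱼuⁱ + ∂ᵢuʲ)/2. -/
def symGrad {n : ℕ} (u : EuclideanSpace ℝ (Fin n) → EuclideanSpace ℝ (Fin n))
    (x : EuclideanSpace ℝ (Fin n)) : Matrix (Fin n) (Fin n) ℝ :=
  fun i j => (pd u j x i + pd u i x j) / 2

/-- Full gradient ∇u(x), entry (i,j) = ∂ⱼuⁱ. -/
def gradM {n : ℕ} (u : EuclideanSpace ℝ (Fin n) → EuclideanSpace ℝ (Fin n))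
    (x : EuclideanSpace ℝ (Fin n)) : Matrix (Fin n) (Fin n) ℝ :=
  fun i j => pd u j x i

/-- Frobenius inner product A : B. -/
def frob {n : ℕ} (A B : Matrix (Fin n) (Fin n) ℝ) : ℝ := ∑ i, ∑ j, A i j * B i j

/-- Frobenius norm |A|. -/
def fnorm {n : ℕ} (A : Matrix (Fin n) (Fin n) ℝ) : ℝ := Real.sqrt (frob A A)

/-- DH(ε) = (h'(|ε|)/|ε|) ε, interpreted as 0 at ε = 0. -/
def DH {n : ℕ} (h : ℝ → ℝ) (A : Matrix (Fin n) (Fin n) ℝ) : Matrix (Fin n) (Fin n) ℝ :=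
  if fnorm A = 0 then 0 else (deriv h (fnorm A) / fnorm A) • A

/-- u is a weak solution of -div DH(ε(u)) + (u·∇)u + ∇π = 0, div u = 0:
for all smooth compactly supported divergence-free φ,
∫ DH(ε(u)) : ε(φ) dx + ∫ uᵏ ∂ₖuⁱ φⁱ dx = 0. -/
def IsWeakSolution {n : ℕ} (h : ℝ → ℝ)
    (u : EuclideanSpace ℝ (Fin n) → EuclideanSpace ℝ (Fin n)) : Prop :=
  ∀ φ : EuclideanSpace ℝ (Fin n) → EuclideanSpace ℝ (Fin n),
    ContDiff ℝ (⊤ : ℕ∞) φ → HasCompactSupport φ → (∀ x, divg φ x = 0) →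
    (∫ x, frob (DH h (symGrad u x)) (symGrad φ x)) +
      (∫ x, ∑ k, ∑ i, u x k * pd u k x i * φ x i) = 0

/-- u is a weak solution of the Stokes-type system -div DH(ε(u)) + ∇π = 0, div u = 0:
for all smooth compactly supported divergence-free φ, ∫ DH(ε(u)) : ε(φ) dx = 0. -/
def IsStokesWeakSolution {n : ℕ} (h : ℝ → ℝ)
    (u : EuclideanSpace ℝ (Fin n) → EuclideanSpace ℝ (Fin n)) : Prop :=
  ∀ φ : EuclideanSpace ℝ (Fin n) → EuclideanSpace ℝ (Fin n),
    ContDiff ℝ (⊤ : ℕ∞) φ → HasCompactSupport φ → (∀ x, divg φ x = 0) →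
    (∫ x, frob (DH h (symGrad u x)) (symGrad φ x)) = 0

/-- The open square Q_R(x₀) ⊂ ℝ². -/
def sqr (R : ℝ) (x₀ : EuclideanSpace ℝ (Fin 2)) : Set (EuclideanSpace ℝ (Fin 2)) :=
  {x | |x 0 - x₀ 0| < R ∧ |x 1 - x₀ 1| < R}

/-- h'(t)/t, extended by h''(0) at t = 0. -/
def slopeH (h : ℝ → ℝ) (t : ℝ) : ℝ :=
  if t = 0 then deriv (deriv h) 0 else deriv h t / t

open scoped Topology

abbrev E2 := EuclideanSpace ℝ (Fin 2)

/-- The standard basis vectors. -/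
def ee (k : Fin 2) : E2 := EuclideanSpace.single k 1

/-- Coordinate functionals. -/
def pr (k : Fin 2) : E2 →L[ℝ] ℝ := EuclideanSpace.proj k

lemma pd_apply {φ : E2 → E2} {x : E2} (hφ : DifferentiableAt ℝ φ x) (k i : Fin 2) :
    pd φ k x i = fderiv ℝ (fun y => φ y i) x (ee k) := by
  have h := ((pr i).hasFDerivAt.comp x hφ.hasFDerivAt).fderiv
  have h2 : (fun y => φ y i) = (pr i) ∘ φ := rfl
  rw [h2, h]; rfl

lemma decomp (x : E2) : x = x 0 • ee 0 + x 1 • ee 1 := by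
  ext i; fin_cases i <;> simp [ee]

lemma coord_le {M : ℝ} {v : E2} (h : ‖v‖ ≤ M) (i : Fin 2) : |v i| ≤ M := by
  have := PiLp.norm_apply_le v i
  exact (this.trans h)

/-- Stream function. -/
lemma exists_stream (u : E2 → E2) (hu : ContDiff ℝ 1 u) (hdiv : ∀ x, divg u x = 0) :
    ∃ ψ : E2 → ℝ, ∀ x, HasFDerivAt ψ
      ((-(u x 1)) • (pr 0)
        + (u x 0) • (pr 1)) x := by
  set p0 := (pr 0)
  set p1 := (pr 1)
  have hd : Differentiable ℝ u := hu.differentiable (by norm_num)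
  have hder : ∀ x, HasFDerivAt (fun x => (-(u x 1)) • p0 + (u x 0) • p1)
      ((-(p1.comp (fderiv ℝ u x))).smulRight p0 + (p0.comp (fderiv ℝ u x)).smulRight p1) x := by
    intro x
    have h1 := p1.hasFDerivAt.comp x (hd x).hasFDerivAt
    have h0 := p0.hasFDerivAt.comp x (hd x).hasFDerivAt
    exact (h1.neg.smul_const p0).add (h0.smul_const p1)
  obtain ⟨ψ, hψ⟩ := convex_univ.exists_forall_hasFDerivAt_of_fderiv_symmetric
    (s := (Set.univ : Set E2)) (ω := fun x => (-(u x 1)) • p0 + (u x 0) • p1) isOpen_univ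
    (fun x _ => (hder x).differentiableAt.differentiableWithinAt) (by
      intro a _ x y
      rw [(hder a).fderiv]
      have hx := decomp x
      have hy := decomp y
      have hD := hdiv a
      simp only [divg, pd, Fin.sum_univ_two] at hD
      change fderiv ℝ u a (ee 0) 0 + fderiv ℝ u a (ee 1) 1 = 0 at hD
      have e1 : ∀ (z : E2) i, fderiv ℝ u a z i = z 0 * fderiv ℝ u a (ee 0) i
          + z 1 * fderiv ℝ u a (ee 1) i := by
        intro z i
        conv_lhs => rw [decomp z]
        simp
      have ep0 : ∀ z : E2, p0 z = z 0 := fun z => rfl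
      have ep1 : ∀ z : E2, p1 z = z 1 := fun z => rfl
      simp only [ContinuousLinearMap.add_apply, ContinuousLinearMap.smulRight_apply,
        ContinuousLinearMap.neg_apply, ContinuousLinearMap.comp_apply,
        ContinuousLinearMap.smul_apply, ep0, ep1, smul_eq_mul]
      rw [e1 x 0, e1 x 1, e1 y 0, e1 y 1]
      linear_combination (x 0 * y 1 - x 1 * y 0) * hD)
  exact ⟨ψ, fun x => hψ x trivial⟩

open scoped ContDiff

lemma integral_div_zero (u : E2 → E2) (hu : ContDiff ℝ 1 u) (hdiv : ∀ x, divg u x = 0)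
    (g : E2 → ℝ) (hg : ContDiff ℝ 1 g) (hc : HasCompactSupport g) :
    Integrable (fun x => u x 0 * fderiv ℝ g x (ee 0) + u x 1 * fderiv ℝ g x (ee 1)) ∧
    ∫ x, (u x 0 * fderiv ℝ g x (ee 0) + u x 1 * fderiv ℝ g x (ee 1)) = 0 := by
  have hd : Differentiable ℝ u := hu.differentiable (by norm_num)
  have hui : ∀ i, ContDiff ℝ 1 (fun x => u x i) := fun i => by fun_prop
  have cg : ∀ k, Continuous (fun x => fderiv ℝ g x (ee k)) := fun k =>
    (hg.continuous_fderiv (by norm_num)).clm_apply continuous_const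
  have cu : ∀ i k, Continuous (fun x => fderiv ℝ (fun y => u y i) x (ee k)) := fun i k =>
    ((hui i).continuous_fderiv (by norm_num)).clm_apply continuous_const
  have hcg : ∀ k, HasCompactSupport (fun x => fderiv ℝ g x (ee k)) := fun k => hc.fderiv_apply ℝ _
  have I1 : ∀ k, Integrable (fun x => u x k * fderiv ℝ g x (ee k)) := fun k =>
    ((hui k).continuous.mul (cg k)).integrable_of_hasCompactSupport (hcg k).mul_left
  have I2 : ∀ k, Integrable (fun x => fderiv ℝ (fun y => u y k) x (ee k) * g x) := fun k =>
    ((cu k k).mul hg.continuous).integrable_of_hasCompactSupport hc.mul_left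
  have I3 : ∀ k, Integrable (fun x => u x k * g x) := fun k =>
    ((hui k).continuous.mul hg.continuous).integrable_of_hasCompactSupport hc.mul_left
  have key : ∀ k, ∫ x, u x k * fderiv ℝ g x (ee k)
      = - ∫ x, fderiv ℝ (fun y => u y k) x (ee k) * g x := fun k =>
    integral_mul_fderiv_eq_neg_fderiv_mul_of_integrable (I2 k) (I1 k) (I3 k)
      (fun x _ => (hui k).differentiable (by norm_num) x)
      (fun x _ => hg.differentiable (by norm_num) x)
  refine ⟨(I1 0).add (I1 1), ?_⟩
  rw [integral_add (I1 0) (I1 1), key 0, key 1, ← neg_add, ← integral_add (I2 0) (I2 1)]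
  have : ∀ x, fderiv ℝ (fun y => u y 0) x (ee 0) * g x
      + fderiv ℝ (fun y => u y 1) x (ee 1) * g x = 0 := by
    intro x
    have := hdiv x
    simp only [divg, Fin.sum_univ_two, pd_apply (hd x)] at this
    rw [← add_mul, this, zero_mul]
  simp [this]

lemma fderiv_scale {f : E2 → ℝ} (hf : Differentiable ℝ f) (r : ℝ) (x₀ x v : E2) :
    fderiv ℝ (fun y => f (r • (y - x₀))) x v = r * fderiv ℝ f (r • (x - x₀)) v := by
  have h1 : HasFDerivAt (fun y : E2 => r • (y - x₀)) (r • ContinuousLinearMap.id ℝ E2) x :=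
    ((hasFDerivAt_id x).sub_const x₀).const_smul r
  have h := ((hf (r • (x - x₀))).hasFDerivAt.comp x h1).fderiv
  have h2 : (fun y => f (r • (y - x₀))) = f ∘ (fun y : E2 => r • (y - x₀)) := rfl
  rw [h2, h]; simp

lemma bdd_of_compact {f : E2 → ℝ} (hf : Continuous f) (hc : HasCompactSupport f) :
    ∃ C : ℝ, 0 ≤ C ∧ ∀ x, |f x| ≤ C := by
  obtain ⟨C, hC⟩ := hc.exists_bound_of_continuous hf
  exact ⟨C, (norm_nonneg _).trans (hC 0), hC⟩

lemma exists_cutoff (x₀ : E2) : ∃ K : ℝ, 0 ≤ K ∧ ∀ R : ℝ, 0 < R → ∃ η : E2 → ℝ,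
    ContDiff ℝ ∞ η ∧ (∀ x, 0 ≤ η x) ∧ (∀ x, η x ≤ 1) ∧
    (∀ x ∈ Metric.closedBall x₀ (3 * R), η x = 1) ∧
    (∀ x, x ∉ Metric.closedBall x₀ (4 * R) → η x = 0 ∧
      (∀ k, fderiv ℝ η x (ee k) = 0) ∧
      ∀ k l, fderiv ℝ (fun y => fderiv ℝ η y (ee k)) x (ee l) = 0) ∧
    (∀ x k, |fderiv ℝ η x (ee k)| ≤ K / R) ∧
    (∀ x k l, |fderiv ℝ (fun y => fderiv ℝ η y (ee k)) x (ee l)| ≤ K / R ^ 2) := by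
  let θ : ContDiffBump (0 : E2) := ⟨3, 4, by norm_num, by norm_num⟩
  have hθ : ContDiff ℝ ∞ θ := θ.contDiff
  have hθc : HasCompactSupport θ := θ.hasCompactSupport
  have hθk : ∀ k, ContDiff ℝ ∞ (fun y => fderiv ℝ θ y (ee k)) := fun k =>
    (hθ.fderiv_right (m := ∞) (by simp)).clm_apply contDiff_const
  have hθkl : ∀ k l, ContDiff ℝ ∞ (fun z => fderiv ℝ (fun y => fderiv ℝ θ y (ee k)) z (ee l)) :=
    fun k l => ((hθk k).fderiv_right (m := ∞) (by simp)).clm_apply contDiff_const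
  have hck : ∀ k, HasCompactSupport (fun y => fderiv ℝ θ y (ee k)) := fun k => hθc.fderiv_apply ℝ _
  have hckl : ∀ k l, HasCompactSupport (fun z => fderiv ℝ (fun y => fderiv ℝ θ y (ee k)) z (ee l)) :=
    fun k l => (hck k).fderiv_apply ℝ _
  choose C1 hC1 hC1' using fun k => bdd_of_compact (hθk k).continuous (hck k)
  choose C2 hC2 hC2' using fun k l => bdd_of_compact (hθkl k l).continuous (hckl k l)
  have hs1 : ∀ k, C1 k ≤ ∑ k, C1 k := fun k =>
    Finset.single_le_sum (fun i _ => hC1 i) (Finset.mem_univ k)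
  have hs2 : ∀ k l, C2 k l ≤ ∑ k, ∑ l, C2 k l := fun k l =>
    (Finset.single_le_sum (fun i _ => hC2 k i) (Finset.mem_univ l)).trans
    (Finset.single_le_sum (f := fun k => ∑ l, C2 k l)
      (fun i _ => Finset.sum_nonneg (fun j _ => hC2 i j)) (Finset.mem_univ k))
  have n1 : 0 ≤ ∑ k, C1 k := (hC1 0).trans (hs1 0)
  have n2 : 0 ≤ ∑ k, ∑ l, C2 k l := (hC2 0 0).trans (hs2 0 0)
  refine ⟨∑ k, C1 k + ∑ k, ∑ l, C2 k l, by positivity, fun R hR => ?_⟩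
  have hcd : ContDiff ℝ ∞ (fun x => θ (R⁻¹ • (x - x₀))) := hθ.comp (by fun_prop)
  have e1 : ∀ k x, fderiv ℝ (fun x => θ (R⁻¹ • (x - x₀))) x (ee k)
      = R⁻¹ * fderiv ℝ θ (R⁻¹ • (x - x₀)) (ee k) := fun k x =>
    fderiv_scale (hθ.differentiable (by simp)) _ _ _ _
  have e2 : ∀ k l x, fderiv ℝ (fun y => fderiv ℝ (fun x => θ (R⁻¹ • (x - x₀))) y (ee k)) x (ee l)
      = R⁻¹ * (R⁻¹ * fderiv ℝ (fun y => fderiv ℝ θ y (ee k)) (R⁻¹ • (x - x₀)) (ee l)) := by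
    intro k l x
    have : (fun y => fderiv ℝ (fun x => θ (R⁻¹ • (x - x₀))) y (ee k))
      = fun y => R⁻¹ * (fun z => fderiv ℝ θ z (ee k)) (R⁻¹ • (y - x₀)) := by
      funext y; exact e1 k y
    rw [this, fderiv_const_mul]
    · rw [_root_.smul_apply, fderiv_scale ((hθk k).differentiable (by simp))]
      rfl
    · exact (((hθk k).comp (g := (fun z => fderiv ℝ θ z (ee k))) (f := fun y => R⁻¹ • (y - x₀))
        (by fun_prop)).differentiable (by simp)) x
  have hnorm : ∀ x, ‖R⁻¹ • (x - x₀)‖ = dist x x₀ / R := by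
    intro x; rw [norm_smul, dist_eq_norm, Real.norm_of_nonneg (by positivity)]; field_simp
  have hout : ∀ x, x ∉ Metric.closedBall x₀ (4 * R) → R⁻¹ • (x - x₀) ∉ tsupport θ := by
    intro x hx
    rw [θ.tsupport_eq]
    simp only [Metric.mem_closedBall, not_le, dist_zero_right, hnorm] at hx ⊢
    rw [lt_div_iff₀ hR]; exact hx
  refine ⟨fun x => θ (R⁻¹ • (x - x₀)), hcd, fun x => θ.nonneg, fun x => θ.le_one, ?_, ?_, ?_, ?_⟩
  · intro x hx
    apply θ.one_of_mem_closedBall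
    simp only [Metric.mem_closedBall, dist_zero_right, hnorm] at hx ⊢
    rw [div_le_iff₀ hR]; exact hx
  · intro x hx
    have h := hout x hx
    refine ⟨image_eq_zero_of_notMem_tsupport h, fun k => ?_, fun k l => ?_⟩
    · rw [e1, fderiv_of_notMem_tsupport ℝ h]; simp
    · rw [e2, fderiv_of_notMem_tsupport ℝ (f := fun y => fderiv ℝ θ y (ee k))]; · simp
      intro h'
      exact h ((tsupport_fderiv_apply_subset ℝ (ee k)) h')
  · intro x k
    rw [e1, abs_mul, abs_of_pos (inv_pos.2 hR), inv_mul_eq_div]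
    gcongr
    exact (hC1' k _).trans ((hs1 k).trans (by linarith))
  · intro x k l
    rw [e2, abs_mul, abs_mul, abs_of_pos (inv_pos.2 hR), ← mul_assoc, ← mul_inv, ← pow_two,
      inv_mul_eq_div]
    gcongr
    exact (hC2' k l _).trans ((hs2 k l).trans (by linarith))

/-- Standard mollifiers. -/
def rho (n : ℕ) : ContDiffBump (0 : E2) :=
  ⟨1 / (2 * ((n : ℝ) + 1)), 1 / ((n : ℝ) + 1), by positivity, by
    apply one_div_lt_one_div_of_lt <;> nlinarith [(Nat.cast_nonneg n : (0 : ℝ) ≤ n)]⟩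

/-- Mollification. -/
def mol (n : ℕ) (g : E2 → E2) : E2 → E2 :=
  convolution ((rho n).normed volume) g (ContinuousLinearMap.lsmul ℝ ℝ) volume

lemma mol_eq (n : ℕ) (g : E2 → E2) (x : E2) :
    mol n g x = ∫ t, (rho n).normed volume t • g (x - t) := by
  simp only [mol, convolution_def, ContinuousLinearMap.lsmul_apply]

lemma rho_tendsto : Tendsto (fun n => (rho n).rOut) atTop (𝓝 0) :=
  tendsto_one_div_add_atTop_nhds_zero_nat

lemma rho_le (n : ℕ) : (rho n).rOut ≤ 1 := by
  change 1 / ((n : ℝ) + 1) ≤ 1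
  rw [div_le_one (by positivity)]
  linarith [(Nat.cast_nonneg n : (0 : ℝ) ≤ n)]

lemma mol_norm_le (n : ℕ) {g : E2 → E2} {B : ℝ} (hB : ∀ x, ‖g x‖ ≤ B) (x : E2) :
    ‖mol n g x‖ ≤ B := by
  rw [mol_eq]
  have : ‖∫ t, (rho n).normed volume t • g (x - t)‖ ≤ ∫ t, (rho n).normed volume t * B := by
    apply norm_integral_le_of_norm_le ((rho n).integrable_normed.mul_const B)
    refine Eventually.of_forall fun t => ?_
    rw [norm_smul, Real.norm_of_nonneg ((rho n).nonneg_normed t)]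
    exact mul_le_mul_of_nonneg_left (hB _) ((rho n).nonneg_normed t)
  rwa [integral_mul_const, (rho n).integral_normed, one_mul] at this

lemma mol_zero (n : ℕ) {g : E2 → E2} {r : ℝ} (hg : ∀ x, x ∉ Metric.closedBall 0 r → g x = 0)
    {x : E2} (hx : x ∉ Metric.closedBall (0 : E2) (r + 1)) : mol n g x = 0 := by
  rw [mol_eq]
  apply integral_eq_zero_of_ae
  refine Eventually.of_forall fun t => ?_
  by_cases ht : t ∈ Function.support ((rho n).normed volume)
  · rw [(rho n).support_normed_eq] at ht
    have : g (x - t) = 0 := by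
      apply hg
      simp only [Metric.mem_closedBall, Metric.mem_ball, dist_zero_right, not_le] at ht hx ⊢
      have h1 := norm_sub_norm_le x t
      have h2 := rho_le n
      linarith
    simp [this]
  · simp only [Function.mem_support, not_not] at ht
    simp [ht]

lemma mol_pd (n : ℕ) {φ : E2 → E2} (hφ : ContDiff ℝ 1 φ) (hc : HasCompactSupport φ)
    (k : Fin 2) (x : E2) : pd (mol n φ) k x = mol n (pd φ k) x := by
  have hl : LocallyIntegrable ((rho n).normed (volume : Measure E2)) :=
    (rho n).integrable_normed.locallyIntegrable
  have h := (hc.hasFDerivAt_convolution_right (ContinuousLinearMap.lsmul ℝ ℝ) hl hφ x).fderiv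
  unfold pd
  unfold mol
  rw [h, convolution_precompR_apply _ hl (hc.fderiv ℝ) (hφ.continuous_fderiv (by norm_num))]

lemma pd_cont {φ : E2 → E2} (hφ : ContDiff ℝ 1 φ) (k : Fin 2) : Continuous (pd φ k) :=
  (hφ.continuous_fderiv (by norm_num)).clm_apply continuous_const

lemma pd_compact {φ : E2 → E2} (hc : HasCompactSupport φ) (k : Fin 2) :
    HasCompactSupport (pd φ k) := hc.fderiv_apply ℝ _

lemma mol_div (n : ℕ) {φ : E2 → E2} (hφ : ContDiff ℝ 1 φ) (hc : HasCompactSupport φ)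
    (hd : ∀ x, divg φ x = 0) (x : E2) : divg (mol n φ) x = 0 := by
  have hI : ∀ k, Integrable (fun t => (rho n).normed volume t • pd φ k (x - t)) := by
    intro k
    apply Continuous.integrable_of_hasCompactSupport
    · exact (rho n).continuous_normed.smul ((pd_cont hφ k).comp (by fun_prop))
    · exact (rho n).hasCompactSupport_normed.smul_right
  have hI' : ∀ k i, (∫ t, (rho n).normed volume t • pd φ k (x - t)) i
      = ∫ t, (rho n).normed volume t * pd φ k (x - t) i := by
    intro k i
    exact ((pr i).integral_comp_comm (hI k)).symm
  have hJ : ∀ k i, Integrable (fun t => (rho n).normed volume t * pd φ k (x - t) i) := by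
    intro k i
    exact (pr i).integrable_comp (hI k)
  simp only [divg, Fin.sum_univ_two, mol_pd n hφ hc, mol_eq, hI']
  rw [← integral_add (hJ 0 0) (hJ 1 1)]
  apply integral_eq_zero_of_ae
  refine Eventually.of_forall fun t => ?_
  have := hd (x - t)
  simp only [divg, Fin.sum_univ_two] at this
  simp [← mul_add, this]

lemma mol_smooth (n : ℕ) {φ : E2 → E2} (hφ : Continuous φ) : ContDiff ℝ (⊤ : ℕ∞) (mol n φ) :=
  (rho n).hasCompactSupport_normed.contDiff_convolution_left _ (rho n).contDiff_normed
    hφ.locallyIntegrable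

lemma mol_tendsto {g : E2 → E2} (hg : Continuous g) (x : E2) :
    Tendsto (fun n => mol n g x) atTop (𝓝 (g x)) :=
  ContDiffBump.convolution_tendsto_right_of_continuous rho_tendsto hg x

lemma abs_le_B {v : E2} {B : ℝ} (h : ‖v‖ ≤ B) (i : Fin 2) : ‖v i‖ ≤ B :=
  (PiLp.norm_apply_le v i).trans h

lemma tendsto_coord {f : ℕ → E2} {v : E2} (h : Tendsto f atTop (𝓝 v)) (i : Fin 2) :
    Tendsto (fun n => f n i) atTop (𝓝 (v i)) :=
  ((pr i).continuous.tendsto v).comp h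

/-- dominated convergence for finitely many products -/
lemma dom_aux {s : E2 → ℝ} {a : ℕ → E2 → ℝ} {b : E2 → ℝ} {r c B : ℝ}
    (hs : Measurable s) (hsb : ∀ x ∈ Metric.closedBall (0 : E2) r, |s x| ≤ c)
    (ha : ∀ n, Continuous (a n))
    (ha0 : ∀ n x, x ∉ Metric.closedBall (0 : E2) r → a n x = 0) (hB : ∀ n x, |a n x| ≤ B)
    (hlim : ∀ x, Tendsto (fun n => a n x) atTop (𝓝 (b x))) :
    (∀ n, Integrable (fun x => s x * a n x)) ∧ Integrable (fun x => s x * b x) ∧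
    Tendsto (fun n => ∫ x, s x * a n x) atTop (𝓝 (∫ x, s x * b x)) := by
  have hbi : Integrable ((Metric.closedBall (0 : E2) r).indicator (fun _ => c * B)) := by
    rw [integrable_indicator_iff measurableSet_closedBall]
    exact integrableOn_const (measure_closedBall_lt_top.ne)
  have hbd : ∀ n x, ‖s x * a n x‖ ≤ (Metric.closedBall (0 : E2) r).indicator (fun _ => c * B) x := by
    intro n x
    by_cases hx : x ∈ Metric.closedBall (0 : E2) r
    · rw [Set.indicator_of_mem hx, norm_mul]
      exact mul_le_mul (hsb x hx) (hB n x) (abs_nonneg _) ((abs_nonneg _).trans (hsb x hx))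
    · rw [Set.indicator_of_notMem hx, ha0 n x hx]; simp
  have hm : ∀ n, AEStronglyMeasurable (fun x => s x * a n x) := fun n =>
    (hs.mul (ha n).measurable).aestronglyMeasurable
  have hl : ∀ x, Tendsto (fun n => s x * a n x) atTop (𝓝 (s x * b x)) := fun x =>
    (hlim x).const_mul _
  refine ⟨fun n => hbi.mono' (hm n) (Eventually.of_forall (hbd n)), ?_, ?_⟩
  · refine hbi.mono' (aestronglyMeasurable_of_tendsto_ae atTop hm (Eventually.of_forall hl)) ?_
    refine Eventually.of_forall fun x => ?_
    exact le_of_tendsto (hl x).norm (Eventually.of_forall fun n => hbd n x)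
  · exact tendsto_integral_of_dominated_convergence _ hm hbi
      (fun n => Eventually.of_forall (hbd n)) (Eventually.of_forall hl)

/-- The weak formulation extends to `C¹` test fields. -/
lemma weak_C1 (S : E2 → Matrix (Fin 2) (Fin 2) ℝ) (c : ℝ)
    (hSm : ∀ i j, Measurable (fun x => S x i j)) (hSb : ∀ x i j, |S x i j| ≤ c)
    (u : E2 → E2) (hu : ContDiff ℝ 1 u)
    (hw : ∀ φ : E2 → E2, ContDiff ℝ (⊤ : ℕ∞) φ → HasCompactSupport φ → (∀ x, divg φ x = 0) →
      (∫ x, frob (S x) (symGrad φ x)) + (∫ x, ∑ k, ∑ i, u x k * pd u k x i * φ x i) = 0)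
    (φ : E2 → E2) (hφ : ContDiff ℝ 1 φ) (hc : HasCompactSupport φ) (hd : ∀ x, divg φ x = 0) :
    Integrable (fun x => frob (S x) (symGrad φ x)) ∧
    Integrable (fun x => ∑ k, ∑ i, u x k * pd u k x i * φ x i) ∧
    (∫ x, frob (S x) (symGrad φ x)) + (∫ x, ∑ k, ∑ i, u x k * pd u k x i * φ x i) = 0 := by
  obtain ⟨r, hr⟩ := hc.isCompact.isBounded.subset_closedBall (0 : E2)
  have hz : ∀ x, x ∉ Metric.closedBall (0 : E2) r → φ x = 0 := fun x hx =>
    image_eq_zero_of_notMem_tsupport (fun h => hx (hr h))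
  have hzk : ∀ k x, x ∉ Metric.closedBall (0 : E2) r → pd φ k x = 0 := fun k x hx =>
    image_eq_zero_of_notMem_tsupport
      (fun h => hx (hr (tsupport_fderiv_apply_subset ℝ (EuclideanSpace.single k 1) h)))
  obtain ⟨B, hB⟩ := hc.exists_bound_of_continuous hφ.continuous
  choose Bk hBk using fun k => (pd_compact hc k).exists_bound_of_continuous (pd_cont hφ k)
  have cpd : ∀ n k, Continuous (pd (mol n φ) k) := fun n k =>
    pd_cont ((mol_smooth n hφ.continuous).of_le (by exact_mod_cast le_top)) k
  -- first part
  have A : ∀ i j, (∀ n, Integrable (fun x => S x i j * symGrad (mol n φ) x i j)) ∧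
      Integrable (fun x => S x i j * symGrad φ x i j) ∧
      Tendsto (fun n => ∫ x, S x i j * symGrad (mol n φ) x i j) atTop
        (𝓝 (∫ x, S x i j * symGrad φ x i j)) := by
    intro i j
    apply dom_aux (a := fun n x => symGrad (mol n φ) x i j) (r := r + 1) (c := c)
      (B := (Bk j + Bk i) / 2) (hSm i j) (fun x _ => hSb x i j)
    · intro n
      unfold symGrad
      have h1 := (pr i).continuous.comp (cpd n j)
      have h2 := (pr j).continuous.comp (cpd n i)
      exact (h1.add h2).div_const 2
    · intro n x hx
      simp [symGrad, mol_pd n hφ hc, mol_zero n (hzk j) hx, mol_zero n (hzk i) hx]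
    · intro n x
      simp only [symGrad, mol_pd n hφ hc]
      have h1 := abs_le_B (mol_norm_le n (hBk j) x) i
      have h2 := abs_le_B (mol_norm_le n (hBk i) x) j
      rw [Real.norm_eq_abs] at h1 h2
      rw [abs_div, abs_two]
      gcongr
      exact (abs_add_le _ _).trans (add_le_add h1 h2)
    · intro x
      simp only [symGrad, mol_pd _ hφ hc]
      exact ((tendsto_coord (mol_tendsto (pd_cont hφ j) x) i).add
        (tendsto_coord (mol_tendsto (pd_cont hφ i) x) j)).div_const 2
  have C : ∀ k i, (∀ n, Integrable (fun x => u x k * pd u k x i * mol n φ x i)) ∧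
      Integrable (fun x => u x k * pd u k x i * φ x i) ∧
      Tendsto (fun n => ∫ x, u x k * pd u k x i * mol n φ x i) atTop
        (𝓝 (∫ x, u x k * pd u k x i * φ x i)) := by
    intro k i
    have hcont : Continuous (fun x => u x k * pd u k x i) :=
      ((pr k).continuous.comp hu.continuous).mul ((pr i).continuous.comp (pd_cont hu k))
    obtain ⟨C, hC⟩ := (isCompact_closedBall (0 : E2) (r + 1)).exists_bound_of_continuousOn
      hcont.continuousOn
    apply dom_aux (s := fun x => u x k * pd u k x i) (a := fun n x => mol n φ x i) (r := r + 1)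
      (c := C) (B := B) hcont.measurable hC
    · intro n
      exact (pr i).continuous.comp (mol_smooth n hφ.continuous).continuous
    · intro n x hx
      simp [mol_zero n hz hx]
    · intro n x
      exact abs_le_B (mol_norm_le n hB x) i
    · intro x
      exact tendsto_coord (mol_tendsto hφ.continuous x) i
  have T1 : ∀ Φ : E2 → E2, (∀ i j, Integrable (fun x => S x i j * symGrad Φ x i j)) →
      ∫ x, frob (S x) (symGrad Φ x) = ∑ i, ∑ j, ∫ x, S x i j * symGrad Φ x i j := by
    intro Φ h
    simp only [frob]
    rw [integral_finsetSum _ (fun i _ => integrable_finsetSum _ (fun j _ => h i j))]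
    exact Finset.sum_congr rfl fun i _ => integral_finsetSum _ (fun j _ => h i j)
  have T2 : ∀ Φ : E2 → E2, (∀ k i, Integrable (fun x => u x k * pd u k x i * Φ x i)) →
      ∫ x, ∑ k, ∑ i, u x k * pd u k x i * Φ x i = ∑ k, ∑ i, ∫ x, u x k * pd u k x i * Φ x i := by
    intro Φ h
    rw [integral_finsetSum _ (fun i _ => integrable_finsetSum _ (fun j _ => h i j))]
    exact Finset.sum_congr rfl fun i _ => integral_finsetSum _ (fun j _ => h i j)
  refine ⟨?_, ?_, ?_⟩
  · simp only [frob]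
    exact integrable_finsetSum _ (fun i _ => integrable_finsetSum _ (fun j _ => (A i j).2.1))
  · exact integrable_finsetSum _ (fun i _ => integrable_finsetSum _ (fun j _ => (C i j).2.1))
  · have hlim : Tendsto (fun n => (∫ x, frob (S x) (symGrad (mol n φ) x))
        + (∫ x, ∑ k, ∑ i, u x k * pd u k x i * mol n φ x i)) atTop
        (𝓝 ((∫ x, frob (S x) (symGrad φ x)) + (∫ x, ∑ k, ∑ i, u x k * pd u k x i * φ x i))) := by
      rw [T1 φ (fun i j => (A i j).2.1), T2 φ (fun i j => (C i j).2.1)]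
      refine Tendsto.congr (fun n => ?_) (Tendsto.add
        (tendsto_finsetSum _ (fun i _ => tendsto_finsetSum _ (fun j _ => (A i j).2.2)))
        (tendsto_finsetSum _ (fun i _ => tendsto_finsetSum _ (fun j _ => (C i j).2.2))))
      rw [T1 _ (fun i j => (A i j).1 n), T2 _ (fun i j => (C i j).1 n)]
    refine tendsto_nhds_unique hlim ?_
    refine tendsto_const_nhds.congr (fun n => ?_)
    exact (hw (mol n φ) (mol_smooth n hφ.continuous)
      (HasCompactSupport.convolution _ (rho n).hasCompactSupport_normed hc)
      (mol_div n hφ hc hd)).symm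

lemma pr_norm_le (i : Fin 2) : ‖pr i‖ ≤ 1 := by
  apply ContinuousLinearMap.opNorm_le_bound _ zero_le_one
  intro x
  rw [one_mul]
  exact PiLp.norm_apply_le x i

/-- Normalised stream function with growth bound. -/
lemma exists_stream' (u : E2 → E2) (hu : ContDiff ℝ 1 u) (hdiv : ∀ x, divg u x = 0)
    (M : ℝ) (hM : ∀ x, ‖u x‖ ≤ M) (x₀ : E2) :
    ∃ ψ : E2 → ℝ, ContDiff ℝ 1 ψ ∧ (∀ x, fderiv ℝ ψ x (ee 0) = - u x 1) ∧
      (∀ x, fderiv ℝ ψ x (ee 1) = u x 0) ∧ ∀ x, |ψ x| ≤ 2 * M * dist x x₀ := by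
  obtain ⟨ψ, hψ⟩ := exists_stream u hu hdiv
  have hψ' : ∀ x, HasFDerivAt (fun y => ψ y - ψ x₀)
      ((-(u x 1)) • (pr 0) + (u x 0) • (pr 1)) x := fun x => (hψ x).sub_const _
  have hci : ∀ i, Continuous (fun x => u x i) := fun i => (pr i).continuous.comp hu.continuous
  refine ⟨fun y => ψ y - ψ x₀, ?_, ?_, ?_, ?_⟩
  · rw [contDiff_one_iff_fderiv]
    refine ⟨fun x => (hψ' x).differentiableAt, ?_⟩
    have : fderiv ℝ (fun y => ψ y - ψ x₀) = fun x => (-(u x 1)) • (pr 0) + (u x 0) • (pr 1) :=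
      funext fun x => (hψ' x).fderiv
    rw [this]
    exact ((hci 1).neg.smul continuous_const).add ((hci 0).smul continuous_const)
  · intro x
    rw [(hψ' x).fderiv]; simp [pr, ee]
  · intro x
    rw [(hψ' x).fderiv]; simp [pr, ee]
  · intro x
    have := convex_univ.norm_image_sub_le_of_norm_hasFDerivWithin_le (f := ψ) (C := 2 * M)
      (s := (Set.univ : Set E2)) (x := x₀) (y := x)
      (fun y _ => (hψ y).hasFDerivWithinAt) (fun y _ => ?_) trivial trivial
    · rw [dist_eq_norm]; exact this
    · refine (norm_add_le _ _).trans ?_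
      rw [norm_smul, norm_smul, norm_neg]
      have h0 := abs_le_B (hM y) 0
      have h1 := abs_le_B (hM y) 1
      have p0 := pr_norm_le 0
      have p1 := pr_norm_le 1
      have := mul_le_mul h1 p0 (norm_nonneg _) ((norm_nonneg _).trans h1)
      have := mul_le_mul h0 p1 (norm_nonneg _) ((norm_nonneg _).trans h0)
      linarith

lemma abs_mul_le' {a b A B : ℝ} (ha : |a| ≤ A) (hb : |b| ≤ B) : |a * b| ≤ A * B := by
  rw [abs_mul]; exact mul_le_mul ha hb (abs_nonneg _) ((abs_nonneg _).trans ha)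

lemma abs_add_le' {a b A B : ℝ} (ha : |a| ≤ A) (hb : |b| ≤ B) : |a + b| ≤ A + B :=
  (abs_add_le a b).trans (add_le_add ha hb)

lemma abs_sub_le' {a b A B : ℝ} (ha : |a| ≤ A) (hb : |b| ≤ B) : |a - b| ≤ A + B :=
  (abs_sub a b).trans (add_le_add ha hb)

/-- The algebraic bound for the error terms. -/
lemma err_bound {c M a b s00 s01 s10 s11 u0 u1 n0 n1 g00 g01 g10 g11 : ℝ}
    (h00 : |s00| ≤ c) (h01 : |s01| ≤ c) (h10 : |s10| ≤ c) (h11 : |s11| ≤ c)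
    (hu0 : |u0| ≤ M) (hu1 : |u1| ≤ M) (hn0 : |n0| ≤ a) (hn1 : |n1| ≤ a)
    (hg00 : |g00| ≤ b) (hg01 : |g01| ≤ b) (hg10 : |g10| ≤ b) (hg11 : |g11| ≤ b) :
    |(s00 * g00 + s01 * ((g01 + g10) / 2) + s10 * ((g10 + g01) / 2) + s11 * g11)
      - (u0 * (u0 * g00) + u0 * (u1 * g10) + u1 * (u0 * g01) + u1 * (u1 * g11))
      + (u0 * n0 + u1 * n1) * ((u0 * u0 + u1 * u1) / 2)|
    ≤ 4 * c * b + 4 * M ^ 2 * b + 2 * M ^ 3 * a := by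
  have hh : |(g01 + g10) / 2| ≤ b := by
    rw [abs_div, abs_two]; linarith [abs_add_le' hg01 hg10]
  have hh' : |(g10 + g01) / 2| ≤ b := by rw [add_comm]; exact hh
  have hv : |(u0 * u0 + u1 * u1) / 2| ≤ M * M := by
    rw [abs_div, abs_two]
    linarith [abs_add_le' (abs_mul_le' hu0 hu0) (abs_mul_le' hu1 hu1)]
  have T1 := abs_add_le' (abs_add_le' (abs_add_le' (abs_mul_le' h00 hg00) (abs_mul_le' h01 hh))
    (abs_mul_le' h10 hh')) (abs_mul_le' h11 hg11)
  have T2 := abs_add_le' (abs_add_le' (abs_add_le' (abs_mul_le' hu0 (abs_mul_le' hu0 hg00))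
    (abs_mul_le' hu0 (abs_mul_le' hu1 hg10))) (abs_mul_le' hu1 (abs_mul_le' hu0 hg01)))
    (abs_mul_le' hu1 (abs_mul_le' hu1 hg11))
  have T3 := abs_mul_le' (abs_add_le' (abs_mul_le' hu0 hn0) (abs_mul_le' hu1 hn1)) hv
  refine (abs_add_le' (abs_sub_le' T1 T2) T3).trans (le_of_eq ?_)
  ring

lemma caccioppoli (S : E2 → Matrix (Fin 2) (Fin 2) ℝ) (c : ℝ)
    (hSb : ∀ x i j, |S x i j| ≤ c)
    (u : E2 → E2) (hu : ContDiff ℝ 1 u) (hdiv : ∀ x, divg u x = 0)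
    (M : ℝ) (hM : ∀ x, ‖u x‖ ≤ M)
    (hw : ∀ φ : E2 → E2, ContDiff ℝ 1 φ → HasCompactSupport φ → (∀ x, divg φ x = 0) →
      Integrable (fun x => frob (S x) (symGrad φ x)) ∧
      Integrable (fun x => ∑ k, ∑ i, u x k * pd u k x i * φ x i) ∧
      (∫ x, frob (S x) (symGrad φ x)) + (∫ x, ∑ k, ∑ i, u x k * pd u k x i * φ x i) = 0)
    (hF : Continuous (fun x => frob (S x) (symGrad u x)))
    (hF0 : ∀ x, 0 ≤ frob (S x) (symGrad u x)) (x₀ : E2) :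
    ∃ C : ℝ, 0 ≤ C ∧ ∀ R : ℝ, 0 < R →
      ∫ x in Metric.closedBall x₀ (3 * R), frob (S x) (symGrad u x) ≤ C * R := by
  have hM0 : 0 ≤ M := (norm_nonneg _).trans (hM 0)
  have hc0 : 0 ≤ c := (abs_nonneg _).trans (hSb 0 0 0)
  obtain ⟨ψ, hψ, hψ0, hψ1, hψb⟩ := exists_stream' u hu hdiv M hM x₀
  obtain ⟨K, hK, hcut⟩ := exists_cutoff x₀
  set V := (volume (Metric.ball (0 : E2) 1)).toReal with hV
  have hV0 : 0 ≤ V := ENNReal.toReal_nonneg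
  refine ⟨(4 * c * (10 * M) + 4 * M ^ 2 * (10 * M) + 2 * M ^ 3) * K * 16 * V, by positivity, ?_⟩
  intro R hR
  obtain ⟨η, hη, hη0, hη1, hηin, hηout, hηk, hηkl⟩ := hcut R hR
  set a := K / R with ha
  have ha0 : 0 ≤ a := by positivity
  have hηd : Differentiable ℝ η := hη.differentiable (by simp)
  have hnk : ∀ k, ContDiff ℝ ∞ (fun y => fderiv ℝ η y (ee k)) := fun k =>
    (hη.fderiv_right (m := ∞) (by simp)).clm_apply contDiff_const
  set n0 : E2 → ℝ := fun y => fderiv ℝ η y (ee 0) with hn0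
  set n1 : E2 → ℝ := fun y => fderiv ℝ η y (ee 1) with hn1
  have hn0' : ContDiff ℝ ∞ n0 := hnk 0
  have hn1' : ContDiff ℝ ∞ n1 := hnk 1
  have hsymm : ∀ x, fderiv ℝ n0 x (ee 1) = fderiv ℝ n1 x (ee 0) := by
    intro x
    have hs : IsSymmSndFDerivAt ℝ η x := hη.contDiffAt.isSymmSndFDerivAt (by simpa using (WithTop.coe_le_coe.2 le_top : ((2:ℕ∞) : WithTop ℕ∞) ≤ ((⊤:ℕ∞) : WithTop ℕ∞)))
    have hd2 : DifferentiableAt ℝ (fderiv ℝ η) x :=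
      ((hη.fderiv_right (m := ∞) (by simp)).differentiable (by simp)) x
    have e : ∀ v w, fderiv ℝ (fun y => fderiv ℝ η y v) x w = fderiv ℝ (fderiv ℝ η) x w v := by
      intro v w
      rw [fderiv_clm_apply hd2 (differentiableAt_const v)]
      simp
    rw [hn0, hn1, e, e]
    exact hs _ _
  have hud : Differentiable ℝ u := hu.differentiable (by norm_num)
  have hui : ∀ i, ContDiff ℝ 1 (fun x => u x i) := fun i => by fun_prop
  have hη1' : ContDiff ℝ 1 η := hη.of_le (by simp)
  have hn01 : ContDiff ℝ 1 n0 := hn0'.of_le (by simp)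
  have hn11 : ContDiff ℝ 1 n1 := hn1'.of_le (by simp)
  set f0 : E2 → ℝ := fun x => η x * u x 0 + ψ x * n1 x with hf0
  set f1 : E2 → ℝ := fun x => η x * u x 1 - ψ x * n0 x with hf1
  have cf0 : ContDiff ℝ 1 f0 := (hη1'.mul (hui 0)).add (hψ.mul hn11)
  have cf1 : ContDiff ℝ 1 f1 := (hη1'.mul (hui 1)).sub (hψ.mul hn01)
  set φ : E2 → E2 := fun x => !₂[f0 x, f1 x] with hφdef
  have φ0 : ∀ x, φ x 0 = f0 x := fun x => by simp [hφdef]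
  have φ1 : ∀ x, φ x 1 = f1 x := fun x => by simp [hφdef]
  have cφ : ContDiff ℝ 1 φ := by
    rw [contDiff_euclidean]
    intro i
    fin_cases i
    · simpa [hφdef] using cf0
    · simpa [hφdef] using cf1
  have z0 : ∀ x, x ∉ Metric.closedBall x₀ (4 * R) → n0 x = 0 := fun x hx => (hηout x hx).2.1 0
  have z1 : ∀ x, x ∉ Metric.closedBall x₀ (4 * R) → n1 x = 0 := fun x hx => (hηout x hx).2.1 1
  have zf0 : ∀ x, x ∉ Metric.closedBall x₀ (4 * R) → f0 x = 0 := fun x hx => by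
    simp [hf0, (hηout x hx).1, z1 x hx]
  have zf1 : ∀ x, x ∉ Metric.closedBall x₀ (4 * R) → f1 x = 0 := fun x hx => by
    simp [hf1, (hηout x hx).1, z0 x hx]
  have hcφ : HasCompactSupport φ := HasCompactSupport.intro (isCompact_closedBall x₀ (4 * R))
    (fun x hx => by ext i; fin_cases i <;> simp [hφdef, zf0 x hx, zf1 x hx])
  have dη : ∀ x, HasFDerivAt η (fderiv ℝ η x) x := fun x => (hηd x).hasFDerivAt
  have dψ : ∀ x, HasFDerivAt ψ (fderiv ℝ ψ x) x := fun x =>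
    (hψ.differentiable (by norm_num) x).hasFDerivAt
  have du : ∀ i x, HasFDerivAt (fun y => u y i) (fderiv ℝ (fun y => u y i) x) x := fun i x =>
    ((hui i).differentiable (by norm_num) x).hasFDerivAt
  have dn0 : ∀ x, HasFDerivAt n0 (fderiv ℝ n0 x) x := fun x =>
    (hn01.differentiable (by norm_num) x).hasFDerivAt
  have dn1 : ∀ x, HasFDerivAt n1 (fderiv ℝ n1 x) x := fun x =>
    (hn11.differentiable (by norm_num) x).hasFDerivAt
  have df0 : ∀ x, HasFDerivAt f0 _ x := fun x => ((dη x).mul (du 0 x)).add ((dψ x).mul (dn1 x))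
  have df1 : ∀ x, HasFDerivAt f1 _ x := fun x => ((dη x).mul (du 1 x)).sub ((dψ x).mul (dn0 x))
  set g : E2 → ℝ := fun x => u x 0 * f0 x + u x 1 * f1 x
    - η x * ((u x 0 * u x 0 + u x 1 * u x 1) * (1 / 2)) with hg
  have cg : ContDiff ℝ 1 g := (((hui 0).mul cf0).add ((hui 1).mul cf1)).sub
    (hη1'.mul ((((hui 0).mul (hui 0)).add ((hui 1).mul (hui 1))).mul contDiff_const))
  have hcg : HasCompactSupport g := HasCompactSupport.intro (isCompact_closedBall x₀ (4 * R))
    (fun x hx => by simp [hg, zf0 x hx, zf1 x hx, (hηout x hx).1])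
  have dg : ∀ x, HasFDerivAt g _ x := fun x =>
    (((du 0 x).mul (df0 x)).add ((du 1 x).mul (df1 x))).sub
    ((dη x).mul ((((du 0 x).mul (du 0 x)).add ((du 1 x).mul (du 1 x))).mul_const (1 / 2)))
  -- error gradients
  set G0 : Fin 2 → E2 → ℝ := fun j x => fderiv ℝ η x (ee j) * u x 0
    + fderiv ℝ ψ x (ee j) * n1 x + ψ x * fderiv ℝ n1 x (ee j) with hG0
  set G1 : Fin 2 → E2 → ℝ := fun j x => fderiv ℝ η x (ee j) * u x 1
    - fderiv ℝ ψ x (ee j) * n0 x - ψ x * fderiv ℝ n0 x (ee j) with hG1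
  have p0 : ∀ j x, pd φ j x 0 = η x * pd u j x 0 + G0 j x := by
    intro j x
    rw [pd_apply (cφ.differentiable (by norm_num) x), pd_apply (hud x)]
    simp only [φ0]
    rw [(df0 x).fderiv]
    simp only [hG0, add_apply, smul_apply, smul_eq_mul]
    ring
  have p1 : ∀ j x, pd φ j x 1 = η x * pd u j x 1 + G1 j x := by
    intro j x
    rw [pd_apply (cφ.differentiable (by norm_num) x), pd_apply (hud x)]
    simp only [φ1]
    rw [(df1 x).fderiv]
    simp only [hG1, add_apply, sub_apply, smul_apply, smul_eq_mul]
    ring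
  have hdivx : ∀ x, pd u 0 x 0 + pd u 1 x 1 = 0 := by
    intro x
    have := hdiv x
    simpa only [divg, Fin.sum_univ_two] using this
  have hdφ : ∀ x, divg φ x = 0 := by
    intro x
    simp only [divg, Fin.sum_univ_two, p0, p1, hG0, hG1, hψ0, hψ1, hsymm]
    change η x * pd u 0 x 0 + (n0 x * _ + _ + _) + (_ + (n1 x * _ - _ - _)) = 0
    linear_combination η x * hdivx x
  obtain ⟨I1, I2, hsum⟩ := hw φ cφ hcφ hdφ
  obtain ⟨I3, hdz⟩ := integral_div_zero u hu hdiv g cg hcg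
  have I4 : Integrable (fun x => η x * frob (S x) (symGrad u x)) :=
    (hη.continuous.mul hF).integrable_of_hasCompactSupport
      (HasCompactSupport.intro (isCompact_closedBall x₀ (4 * R))
        (fun x hx => by simp [(hηout x hx).1]))
  set err : E2 → ℝ := fun x => frob (S x) (symGrad φ x)
    + (∑ k, ∑ i, u x k * pd u k x i * φ x i)
    - (u x 0 * fderiv ℝ g x (ee 0) + u x 1 * fderiv ℝ g x (ee 1))
    - η x * frob (S x) (symGrad u x) with herr
  have I5 : Integrable err := ((I1.add I2).sub I3).sub I4
  have herrint : ∫ x, err x = - ∫ x, η x * frob (S x) (symGrad u x) := by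
    have e1 : ∫ x, err x = _ := integral_sub ((I1.add I2).sub I3) I4
    have e2 := integral_sub (I1.add I2) I3
    have e3 := integral_add I1 I2
    simp only [Pi.add_apply, Pi.sub_apply] at e1 e2 e3
    rw [e1, e2, e3, hsum, hdz]; ring
  have dgx : ∀ k x, fderiv ℝ g x (ee k) =
      pd u k x 0 * f0 x + pd u k x 1 * f1 x + (u x 0 * G0 k x + u x 1 * G1 k x)
      - fderiv ℝ η x (ee k) * ((u x 0 * u x 0 + u x 1 * u x 1) / 2) := by
    intro k x
    rw [(dg x).fderiv, pd_apply (hud x), pd_apply (hud x)]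
    simp only [hG0, hG1, add_apply, sub_apply, smul_apply, smul_eq_mul]
    ring
  have herr2 : ∀ x, err x = (S x 0 0 * G0 0 x + S x 0 1 * ((G0 1 x + G1 0 x) / 2)
      + S x 1 0 * ((G1 0 x + G0 1 x) / 2) + S x 1 1 * G1 1 x)
      - (u x 0 * (u x 0 * G0 0 x) + u x 0 * (u x 1 * G1 0 x) + u x 1 * (u x 0 * G0 1 x)
        + u x 1 * (u x 1 * G1 1 x))
      + (u x 0 * n0 x + u x 1 * n1 x) * ((u x 0 * u x 0 + u x 1 * u x 1) / 2) := by
    intro x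
    simp only [herr, frob, symGrad, Fin.sum_univ_two, p0, p1, dgx, φ0, φ1, hn0, hn1]
    ring
  have hbound : ∀ x, ‖err x‖ ≤ (Metric.closedBall x₀ (4 * R)).indicator
      (fun _ => 4 * c * (10 * M * a) + 4 * M ^ 2 * (10 * M * a) + 2 * M ^ 3 * a) x := by
    intro x
    by_cases hx : x ∈ Metric.closedBall x₀ (4 * R)
    · rw [Set.indicator_of_mem hx, herr2, Real.norm_eq_abs]
      have hu0 := coord_le (hM x) 0
      have hu1 := coord_le (hM x) 1
      have hψx : |ψ x| ≤ 8 * M * R := by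
        refine (hψb x).trans ?_
        have : dist x x₀ ≤ 4 * R := hx
        nlinarith
      have hψ2 : ∀ k l, |ψ x * fderiv ℝ (fun y => fderiv ℝ η y (ee k)) x (ee l)| ≤ 8 * M * a := by
        intro k l
        refine (abs_mul_le' hψx (hηkl x k l)).trans (le_of_eq ?_)
        rw [ha]; field_simp
      have hψ3 : ∀ j, |fderiv ℝ ψ x (ee j)| ≤ M := by
        intro j
        fin_cases j
        · simp only [Fin.zero_eta, hψ0, abs_neg]; exact hu1
        · simp only [Fin.mk_one, hψ1]; exact hu0
      have b0 : ∀ j, |G0 j x| ≤ 10 * M * a := by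
        intro j
        refine (abs_add_le' (abs_add_le' (abs_mul_le' (hηk x j) hu0)
          (abs_mul_le' (hψ3 j) (hηk x 1))) (hψ2 1 j)).trans (le_of_eq ?_)
        ring
      have b1 : ∀ j, |G1 j x| ≤ 10 * M * a := by
        intro j
        refine (abs_sub_le' (abs_sub_le' (abs_mul_le' (hηk x j) hu1)
          (abs_mul_le' (hψ3 j) (hηk x 0))) (hψ2 0 j)).trans (le_of_eq ?_)
        ring
      exact err_bound (hSb x 0 0) (hSb x 0 1) (hSb x 1 0) (hSb x 1 1) hu0 hu1 (hηk x 0) (hηk x 1)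
        (b0 0) (b0 1) (b1 0) (b1 1)
    · rw [Set.indicator_of_notMem hx, herr2]
      obtain ⟨-, q1, q2⟩ := hηout x hx
      have b0 : ∀ j, G0 j x = 0 := fun j => by
        simp [hG0, q1 j, z1 x hx, hn1, q2 1 j]
        exact Or.inr (q1 1)
      have b1 : ∀ j, G1 j x = 0 := fun j => by
        simp [hG1, q1 j, z0 x hx, hn0, q2 0 j]
        exact Or.inr (q1 0)
      simp [b0, b1, z0 x hx, z1 x hx]
  have hvol : (volume (Metric.closedBall x₀ (4 * R))).toReal = 16 * R ^ 2 * V := by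
    rw [Measure.addHaar_closedBall _ _ (by positivity), ENNReal.toReal_mul,
      ENNReal.toReal_ofReal (by positivity)]
    simp only [finrank_euclideanSpace, Fintype.card_fin, hV]
    ring
  have hbi : Integrable ((Metric.closedBall x₀ (4 * R)).indicator
      (fun _ => 4 * c * (10 * M * a) + 4 * M ^ 2 * (10 * M * a) + 2 * M ^ 3 * a)) := by
    rw [integrable_indicator_iff measurableSet_closedBall]
    exact integrableOn_const (measure_closedBall_lt_top.ne)
  have hfin : ∫ x, η x * frob (S x) (symGrad u x)
      ≤ (4 * c * (10 * M) + 4 * M ^ 2 * (10 * M) + 2 * M ^ 3) * K * 16 * V * R := by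
    have h1 := norm_integral_le_of_norm_le hbi (Eventually.of_forall hbound)
    rw [integral_indicator measurableSet_closedBall, setIntegral_const, herrint, norm_neg,
      Measure.real, hvol, smul_eq_mul] at h1
    refine (le_abs_self _).trans (h1.trans (le_of_eq ?_))
    rw [ha]; field_simp
  refine le_trans ?_ hfin
  rw [← integral_indicator measurableSet_closedBall]
  refine integral_mono_of_nonneg (Eventually.of_forall fun x => ?_) I4
    (Eventually.of_forall fun x => ?_)
  · exact Set.indicator_nonneg (fun y _ => hF0 y) x
  · by_cases hx : x ∈ Metric.closedBall x₀ (3 * R)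
    · simp only [Set.indicator_of_mem hx, hηin x hx, one_mul]; exact le_rfl
    · simp only [Set.indicator_of_notMem hx]
      exact mul_nonneg (hη0 x) (hF0 x)


lemma frob_self_nonneg (A : Matrix (Fin 2) (Fin 2) ℝ) : 0 ≤ frob A A := by
  unfold frob
  exact Finset.sum_nonneg fun i _ => Finset.sum_nonneg fun j _ => mul_self_nonneg _

lemma fnorm_nonneg' (A : Matrix (Fin 2) (Fin 2) ℝ) : 0 ≤ fnorm A := Real.sqrt_nonneg _

lemma fnorm_mul_self (A : Matrix (Fin 2) (Fin 2) ℝ) : fnorm A * fnorm A = frob A A :=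
  Real.mul_self_sqrt (frob_self_nonneg A)

lemma entry_le_fnorm (A : Matrix (Fin 2) (Fin 2) ℝ) (i j : Fin 2) : |A i j| ≤ fnorm A := by
  apply Real.abs_le_sqrt
  have a := mul_self_nonneg (A 0 0)
  have b := mul_self_nonneg (A 0 1)
  have c := mul_self_nonneg (A 1 0)
  have d := mul_self_nonneg (A 1 1)
  simp only [frob, Fin.sum_univ_two]
  fin_cases i <;> fin_cases j <;> simp only [Fin.zero_eta, Fin.mk_one, Fin.isValue] <;> nlinarith

lemma frob_DH (h : ℝ → ℝ) (A : Matrix (Fin 2) (Fin 2) ℝ) :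
    frob (DH h A) A = deriv h (fnorm A) * fnorm A := by
  unfold DH
  split_ifs with h1
  · simp [frob, h1]
  · have e : frob ((deriv h (fnorm A) / fnorm A) • A) A
        = (deriv h (fnorm A) / fnorm A) * frob A A := by
      simp only [frob, Fin.sum_univ_two, Matrix.smul_apply, smul_eq_mul]
      ring
    rw [e, ← fnorm_mul_self]
    field_simp

lemma abs_DH_le (h : ℝ → ℝ) (c : ℝ) (hc : 0 ≤ c) (hh : ∀ t, 0 ≤ t → |deriv h t| ≤ c)
    (A : Matrix (Fin 2) (Fin 2) ℝ) (i j : Fin 2) : |DH h A i j| ≤ c := by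
  unfold DH
  split_ifs with h1
  · simpa using hc
  · have hp : 0 < fnorm A := lt_of_le_of_ne (fnorm_nonneg' A) (Ne.symm h1)
    rw [Matrix.smul_apply, smul_eq_mul, abs_mul, abs_div, abs_of_pos hp]
    calc |deriv h (fnorm A)| / fnorm A * |A i j|
        ≤ |deriv h (fnorm A)| / fnorm A * fnorm A := by
          gcongr
          exact entry_le_fnorm A i j
      _ = |deriv h (fnorm A)| := by field_simp
      _ ≤ c := hh _ hp.le

lemma symGrad_cont {u : E2 → E2} (hu : ContDiff ℝ 1 u) (i j : Fin 2) :
    Continuous (fun x => symGrad u x i j) := by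
  have a := pd_cont hu i
  have b := pd_cont hu j
  unfold symGrad
  fun_prop

lemma fnorm_cont {u : E2 → E2} (hu : ContDiff ℝ 1 u) :
    Continuous (fun x => fnorm (symGrad u x)) := by
  have a := fun i j => symGrad_cont hu i j
  unfold fnorm frob
  apply Continuous.sqrt
  exact continuous_finsetSum _ fun i _ => continuous_finsetSum _ fun j _ => (a i j).mul (a i j)

lemma DH_meas {u : E2 → E2} (hu : ContDiff ℝ 1 u) (h : ℝ → ℝ) (i j : Fin 2) :
    Measurable (fun x => DH h (symGrad u x) i j) := by
  have e : (fun x => DH h (symGrad u x) i j) = fun x => if fnorm (symGrad u x) = 0 then (0:ℝ)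
      else (deriv h (fnorm (symGrad u x)) / fnorm (symGrad u x)) * symGrad u x i j := by
    funext x
    unfold DH
    split_ifs <;> simp
  rw [e]
  have m := (fnorm_cont hu).measurable
  refine Measurable.ite (m (measurableSet_singleton 0)) measurable_const ?_
  exact (((measurable_deriv h).comp m).div m).mul (symGrad_cont hu i j).measurable

/-- Elementary consequences of the ellipticity bounds. -/
lemma h_facts
    (h : ℝ → ℝ) (c₁ c₂ μ : ℝ)
    (hc₁ : 0 < c₁) (hc₂ : 0 < c₂) (hμ₁ : 1 < μ)
    (hreg : ContDiff ℝ 2 h) (h0' : deriv h 0 = 0)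
    (hlow : ∀ t, 0 ≤ t →
      c₁ * (1 + t) ^ (-μ) ≤ min (deriv (deriv h) t) (slopeH h t))
    (hup : ∀ t, 0 ≤ t →
      max (deriv (deriv h) t) (slopeH h t) ≤ c₂ / (1 + t)) :
    Continuous (deriv h) ∧ (∀ t, 0 ≤ t → 0 ≤ deriv h t) ∧ (∀ t, 0 ≤ t → |deriv h t| ≤ c₂) ∧
    ∃ c, 0 < c ∧ ∀ δ, 0 < δ → δ ≤ 1 → ∀ t, 0 ≤ t → t ≤ δ + (c * δ)⁻¹ * (deriv h t * t) := by
  have hd1 : ContDiff ℝ 1 (deriv h) := by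
    have : ContDiff ℝ (1 + 1) h := by simpa [one_add_one_eq_two] using hreg
    exact (contDiff_succ_iff_deriv.1 this).2.2
  have hcont := hd1.continuous
  have hmono : MonotoneOn (deriv h) (Set.Ici 0) := by
    apply monotoneOn_of_deriv_nonneg (convex_Ici 0) hcont.continuousOn
    · exact (hd1.differentiable (by simp)).differentiableOn
    · intro t ht
      rw [interior_Ici] at ht
      have ht' : (0:ℝ) < t := ht
      have := (hlow t ht'.le).trans (min_le_left _ _)
      refine le_trans ?_ this
      positivity
  have hnn : ∀ t, 0 ≤ t → 0 ≤ deriv h t := fun t ht => by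
    rw [← h0']
    exact hmono (Set.mem_Ici.2 le_rfl) ht ht
  have hle : ∀ t, 0 ≤ t → deriv h t ≤ c₂ := fun t ht => by
    rcases ht.eq_or_lt with rfl | ht'
    · rw [h0']; exact hc₂.le
    · have := (le_max_right _ _).trans (hup t ht)
      rw [slopeH, if_neg ht'.ne', div_le_div_iff₀ ht' (by positivity)] at this
      have hn := hnn t ht
      by_contra hcon
      push Not at hcon
      nlinarith
  refine ⟨hcont, hnn, fun t ht => by rw [abs_of_nonneg (hnn t ht)]; exact hle t ht, ?_⟩
  set c := c₁ * (2:ℝ) ^ (-μ) with hc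
  have hcpos : 0 < c := by positivity
  have hlin : ∀ t, 0 ≤ t → t ≤ 1 → c * t ≤ deriv h t := fun t ht ht1 => by
    rcases ht.eq_or_lt with rfl | ht'
    · simp [h0']
    · have := (hlow t ht).trans (min_le_right _ _)
      rw [slopeH, if_neg ht'.ne', le_div_iff₀ ht'] at this
      refine le_trans ?_ this
      have h2 : (2:ℝ) ^ (-μ) ≤ (1 + t) ^ (-μ) :=
        Real.rpow_le_rpow_of_nonpos (by linarith) (by linarith) (by linarith)
      rw [hc]
      gcongr
  refine ⟨c, hcpos, fun δ hδ hδ1 t ht => ?_⟩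
  rcases le_total t δ with h1 | h1
  · have : 0 ≤ (c * δ)⁻¹ * (deriv h t * t) := by
      have := hnn t ht
      positivity
    linarith
  · have h2 : c * δ ≤ deriv h t :=
      (hlin δ hδ.le hδ1).trans (hmono (Set.mem_Ici.2 hδ.le) ht h1)
    have h3 : (c * δ)⁻¹ * (c * δ * t) ≤ (c * δ)⁻¹ * (deriv h t * t) := by gcongr
    have h4 : (c * δ)⁻¹ * (c * δ * t) = t := by field_simp
    linarith

lemma sqr_subset (R : ℝ) (hR : 0 < R) (x₀ : E2) :
    sqr (2 * R) x₀ ⊆ Metric.closedBall x₀ (3 * R) := by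
  intro x hx
  obtain ⟨a, b⟩ := hx
  rw [Metric.mem_closedBall, EuclideanSpace.dist_eq]
  apply Real.sqrt_le_iff.2
  refine ⟨by positivity, ?_⟩
  simp only [Fin.sum_univ_two, Real.dist_eq]
  have := abs_nonneg (x 0 - x₀ 0)
  have := abs_nonneg (x 1 - x₀ 1)
  nlinarith

/-- 'epstonull' in the proof of Theorem 3: for a μ-elliptic density with
1 < μ < 2 and a bounded divergence-free weak solution u, the mean of |ε(u)| over large
squares vanishes: R^{-2} ∫_{Q_{2R}(x₀)} |ε(u)| dx → 0 as R → ∞. -/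
theorem mean_symmetric_gradient_tendsto_zero
    (h : ℝ → ℝ) (c₁ c₂ μ : ℝ)
    (hc₁ : 0 < c₁) (hc₂ : 0 < c₂) (hμ₁ : 1 < μ) (hμ₂ : μ < 2)
    (hreg : ContDiff ℝ 2 h)
    (hnonneg : ∀ t, 0 ≤ t → 0 ≤ h t)
    (h0 : h 0 = 0) (h0' : deriv h 0 = 0)
    (hlow : ∀ t, 0 ≤ t →
      c₁ * (1 + t) ^ (-μ) ≤ min (deriv (deriv h) t) (slopeH h t))
    (hup : ∀ t, 0 ≤ t →
      max (deriv (deriv h) t) (slopeH h t) ≤ c₂ / (1 + t))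
    (u : EuclideanSpace ℝ (Fin 2) → EuclideanSpace ℝ (Fin 2))
    (hu : ContDiff ℝ 1 u)
    (hdiv : ∀ x, divg u x = 0)
    (hbdd : ∃ M : ℝ, ∀ x, ‖u x‖ ≤ M)
    (hweak : IsWeakSolution h u) :
    ∀ x₀ : EuclideanSpace ℝ (Fin 2),
      Tendsto (fun R : ℝ => (∫ x in sqr (2 * R) x₀, fnorm (symGrad u x)) / R ^ 2)
        atTop (nhds 0) := by
  intro x₀
  obtain ⟨M, hM⟩ := hbdd
  obtain ⟨hcont, hnn, habs, c, hc, hδ⟩ := h_facts h c₁ c₂ μ hc₁ hc₂ hμ₁ hreg h0' hlow hup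
  have hFe : ∀ x, frob (DH h (symGrad u x)) (symGrad u x)
      = deriv h (fnorm (symGrad u x)) * fnorm (symGrad u x) := fun x => frob_DH h _
  have hg := fnorm_cont hu
  have hF : Continuous (fun x => frob (DH h (symGrad u x)) (symGrad u x)) := by
    simp only [hFe]
    exact (hcont.comp hg).mul hg
  have hF0 : ∀ x, 0 ≤ frob (DH h (symGrad u x)) (symGrad u x) := fun x => by
    rw [hFe]
    exact mul_nonneg (hnn _ (fnorm_nonneg' _)) (fnorm_nonneg' _)
  have hSb := fun x i j => abs_DH_le h c₂ hc₂.le habs (symGrad u x) i j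
  obtain ⟨C, hC, hcac⟩ := caccioppoli (fun x => DH h (symGrad u x)) c₂ hSb u hu hdiv M hM
    (fun φ hφ hφc hφd => weak_C1 (fun x => DH h (symGrad u x)) c₂
      (fun i j => DH_meas hu h i j) hSb u hu hweak φ hφ hφc hφd) hF hF0 x₀
  set V := (volume (Metric.ball (0 : E2) 1)).toReal with hV
  have key : ∀ δ R : ℝ, 0 < δ → δ ≤ 1 → 0 < R →
      (∫ x in sqr (2 * R) x₀, fnorm (symGrad u x)) / R ^ 2
        ≤ 9 * V * δ + (c * δ)⁻¹ * C / R := by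
    intro δ R hδ0 hδ1 hR
    have hk := isCompact_closedBall x₀ (3 * R)
    have i1 := hg.continuousOn.integrableOn_compact (μ := volume) hk
    have i2 := hF.continuousOn.integrableOn_compact (μ := volume) hk
    have i0 : IntegrableOn (fun _ : E2 => δ) (Metric.closedBall x₀ (3 * R)) volume :=
      continuous_const.continuousOn.integrableOn_compact hk
    have hvol : (volume (Metric.closedBall x₀ (3 * R))).toReal = 9 * R ^ 2 * V := by
      rw [Measure.addHaar_closedBall _ _ (by positivity), ENNReal.toReal_mul,
        ENNReal.toReal_ofReal (by positivity)]
      simp only [finrank_euclideanSpace, Fintype.card_fin, hV]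
      ring
    have s1 : (∫ x in sqr (2 * R) x₀, fnorm (symGrad u x))
        ≤ ∫ x in Metric.closedBall x₀ (3 * R), fnorm (symGrad u x) :=
      setIntegral_mono_set i1 (Eventually.of_forall fun x => fnorm_nonneg' _)
        (Eventually.of_forall (sqr_subset R hR x₀))
    have s2 : (∫ x in Metric.closedBall x₀ (3 * R), fnorm (symGrad u x))
        ≤ ∫ x in Metric.closedBall x₀ (3 * R),
          (δ + (c * δ)⁻¹ * frob (DH h (symGrad u x)) (symGrad u x)) := by
      apply integral_mono i1 (i0.add (i2.const_mul _))
      intro x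
      have := hδ δ hδ0 hδ1 (fnorm (symGrad u x)) (fnorm_nonneg' _)
      rw [← hFe] at this
      exact this
    have s3 : (∫ x in Metric.closedBall x₀ (3 * R),
          (δ + (c * δ)⁻¹ * frob (DH h (symGrad u x)) (symGrad u x)))
        = 9 * R ^ 2 * V * δ + (c * δ)⁻¹ *
          ∫ x in Metric.closedBall x₀ (3 * R), frob (DH h (symGrad u x)) (symGrad u x) := by
      rw [integral_add i0 (i2.const_mul _), integral_const_mul, setIntegral_const,
        smul_eq_mul, Measure.real, hvol]
    have s4 : (c * δ)⁻¹ * (∫ x in Metric.closedBall x₀ (3 * R),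
        frob (DH h (symGrad u x)) (symGrad u x)) ≤ (c * δ)⁻¹ * (C * R) :=
      mul_le_mul_of_nonneg_left (hcac R hR) (by positivity)
    rw [div_le_iff₀ (by positivity)]
    have e : (9 * V * δ + (c * δ)⁻¹ * C / R) * R ^ 2
        = 9 * R ^ 2 * V * δ + (c * δ)⁻¹ * (C * R) := by
      field_simp
    rw [e]
    linarith
  have l1 : Tendsto (fun R : ℝ => 9 * V * (Real.sqrt R)⁻¹ + C / c * (Real.sqrt R)⁻¹)
      atTop (nhds 0) := by
    have l0 : Tendsto (fun R : ℝ => (Real.sqrt R)⁻¹) atTop (nhds 0) :=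
      tendsto_inv_atTop_zero.comp Real.tendsto_sqrt_atTop
    simpa using (l0.const_mul (9 * V)).add (l0.const_mul (C / c))
  refine tendsto_of_tendsto_of_tendsto_of_le_of_le' tendsto_const_nhds l1 ?_ ?_
  · exact Eventually.of_forall fun R =>
      div_nonneg (integral_nonneg fun x => fnorm_nonneg' _) (sq_nonneg R)
  · filter_upwards [eventually_ge_atTop 1] with R hR
    have hs : 1 ≤ Real.sqrt R := Real.one_le_sqrt.2 hR
    have hs0 : 0 < Real.sqrt R := by linarith
    have hk := key (Real.sqrt R)⁻¹ R (by positivity) (inv_le_one_of_one_le₀ hs) (by linarith)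
    refine hk.trans (le_of_eq ?_)
    have e : R = Real.sqrt R * Real.sqrt R := (Real.mul_self_sqrt (by linarith)).symm
    congr 1
    generalize Real.sqrt R = s at e hs0
    subst e
    field_simp
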